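/- arXiv:2605.30509 — 6 statements merged into one kernel-verified Lean document; each statement's English description precedes it below -/
import Mathlib

section
/- There exist universal constants c > 0, C > 0, and a natural number n₀ such that for all n ≥ n₀ the following holds. Let p* = (1/2, 1/2, 0, 0, …) be the two-point distribution on ℕ. Then Δ_n(p*) ≥ c·Δ_n(p) for every probability distribution p on ℕ, and consequently c·n^{-1/2} ≤ sup_p Δ_n(p) ≤ C·n^{-1/2}, where the supremum is over all probability distributions on ℕ. -/
open MeasureTheory
open scoped BigOperators

noncomputable section

/-- `p` is a probability distribution on `ℕ`. -/
def IsProbDist (p : ℕ → ℝ) : Prop := (∀ i, 0 ≤ p i) ∧ (∑' i, p i) = 1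

/-- The `k`-th largest value (for `k ≥ 1`) of the sequence `p`:
the `k`-th entry of the nonincreasing rearrangement `p↓`. -/
def dRe (p : ℕ → ℝ) (k : ℕ) : ℝ :=
  sSup {x : ℝ | ∃ s : Finset ℕ, s.card = k ∧ ∀ i ∈ s, x ≤ p i}

/-- `S(p) = sup_{j ≥ 1} p↓_j log (j+1)`. -/
def Sfun (p : ℕ → ℝ) : ℝ := ⨆ j : ℕ, dRe p (j + 1) * Real.log ((j : ℝ) + 2)

/-- `M(p) = sup_{j ≥ 1} log(j+1) / log (2 + log(j+1)/(n p↓_j))`, with the convention that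
a term vanishes when `n·p↓_j = 0`. -/
def Mfun (p : ℕ → ℝ) (n : ℕ) : ℝ :=
  ⨆ j : ℕ,
    if 0 < (n : ℝ) * dRe p (j + 1) then
      Real.log ((j : ℝ) + 2) /
        Real.log (2 + Real.log ((j : ℝ) + 2) / ((n : ℝ) * dRe p (j + 1)))
    else 0

/-- `v_i(p) = p_i (1 - p_i)`. -/
def vfun (p : ℕ → ℝ) (i : ℕ) : ℝ := p i * (1 - p i)

/-- `V*(p) = sup_{i ≥ 1} p↓_i (1 - p↓_i) log (i+1)`. -/
def VstarF (p : ℕ → ℝ) : ℝ :=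
  ⨆ j : ℕ, dRe p (j + 1) * (1 - dRe p (j + 1)) * Real.log ((j : ℝ) + 2)

/-- sup-norm of a sequence: `‖q‖_∞ = sup_i |q_i|`. -/
def supNorm (q : ℕ → ℝ) : ℝ := ⨆ i : ℕ, |q i|

/-- the empirical pmf of the sample `ω = (X_1, …, X_n)`. -/
def emp (n : ℕ) (ω : Fin n → ℕ) (i : ℕ) : ℝ :=
  ((Finset.univ.filter fun t => ω t = i).card : ℝ) / n

/-- the i.i.d. weight of a sample `ω`. -/
def wt (p : ℕ → ℝ) {n : ℕ} (ω : Fin n → ℕ) : ℝ := ∏ t, p (ω t)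

/-- expectation, under `n` i.i.d. samples from `p`, of `f`. -/
def expect (p : ℕ → ℝ) (n : ℕ) (f : (Fin n → ℕ) → ℝ) : ℝ :=
  ∑' ω : Fin n → ℕ, wt p ω * f ω

/-- probability, under `n` i.i.d. samples from `p`, of the event `E`. -/
def probEvt (p : ℕ → ℝ) (n : ℕ) (E : Set (Fin n → ℕ)) : ℝ :=
  ∑' ω : E, wt p (ω : Fin n → ℕ)

/-- `Δ_n(p) = E_p ‖p̂ - p‖_∞`. -/
def Deln (p : ℕ → ℝ) (n : ℕ) : ℝ :=
  expect p n fun ω => supNorm fun i => emp n ω i - p i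

/-- The two-point distribution `p* = (1/2, 1/2, 0, 0, …)`. -/
def pstar : ℕ → ℝ := fun i => if i < 2 then 1 / 2 else 0

theorem sum_fin_two_cons {n : ℕ} (F : (Fin (n + 1) → Fin 2) → ℝ) :
    ∑ b, F b = (∑ b : Fin n → Fin 2, F (Fin.cons 0 b)) + ∑ b : Fin n → Fin 2, F (Fin.cons 1 b) := by
  rw [← (Fin.consEquiv fun _ : Fin (n + 1) => Fin 2).sum_comp, Fintype.sum_prod_type,
    Fin.sum_univ_two]
  rfl

/-- The sign attached to an outcome of a fair coin. -/
def coinSign (b : Fin 2) : ℝ := if b = 0 then 1 else -1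

theorem sum_coinSign_sq (n : ℕ) (x : ℝ) :
    ∑ b : Fin n → Fin 2, (x + ∑ t, coinSign (b t)) ^ 2 = 2 ^ n * (x ^ 2 + n) := by
  induction n generalizing x with
  | zero => simp
  | succ n ih =>
    rw [sum_fin_two_cons]
    simp only [Fin.sum_univ_succ, Fin.cons_zero, Fin.cons_succ, ← add_assoc, ih]
    simp only [coinSign]
    push_cast
    ring

theorem sum_coinSign_pow_four (n : ℕ) (x : ℝ) :
    ∑ b : Fin n → Fin 2, (x + ∑ t, coinSign (b t)) ^ 4 =
      2 ^ n * (x ^ 4 + 6 * x ^ 2 * n + 3 * n ^ 2 - 2 * n) := by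
  induction n generalizing x with
  | zero => simp
  | succ n ih =>
    rw [sum_fin_two_cons]
    simp only [Fin.sum_univ_succ, Fin.cons_zero, Fin.cons_succ, ← add_assoc, ih]
    simp only [coinSign]
    push_cast
    ring

theorem sq_sub_pow_four_le_abs (y : ℝ) : y ^ 2 - y ^ 4 / 6 ≤ |y| := by
  have h : |y| - |y| ^ 3 / 6 ≤ 1 := by
    have := abs_nonneg y
    nlinarith [mul_nonneg (add_nonneg this zero_le_two) (sq_nonneg (|y| - 3 / 2)),
      sq_nonneg (|y| - 3 / 2), sq_nonneg (|y| - 7 / 5),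
      mul_nonneg this (sq_nonneg (|y| - 7 / 5))]
  have h2 : y ^ 2 - y ^ 4 / 6 = |y| * (|y| - |y| ^ 3 / 6) := by
    rw [show y ^ 4 = (y ^ 2) ^ 2 by ring, ← sq_abs y]; ring
  rw [h2]
  exact mul_le_of_le_one_right (abs_nonneg y) h

theorem sum_abs_coinSign_ge {n : ℕ} (hn : 0 < n) :
    2 ^ n * (√n / 2) ≤ ∑ b : Fin n → Fin 2, |∑ t, coinSign (b t)| := by
  have hn' : (0 : ℝ) < n := by exact_mod_cast hn
  set s := √(n : ℝ) with hs
  have hs0 : 0 < s := Real.sqrt_pos.2 hn'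
  have hs2 : s ^ 2 = n := Real.sq_sqrt hn'.le
  have key (z : ℝ) : (1 / s) * z ^ 2 - (1 / (6 * s ^ 3)) * z ^ 4 ≤ |z| := by
    have h := mul_le_mul_of_nonneg_left (sq_sub_pow_four_le_abs (z / s)) hs0.le
    rw [abs_div, abs_of_pos hs0, mul_div_cancel₀ _ hs0.ne'] at h
    refine le_trans (le_of_eq ?_) h
    field_simp
  calc 2 ^ n * (s / 2)
      ≤ (1 / s) * (2 ^ n * ((0 : ℝ) ^ 2 + n)) -
        (1 / (6 * s ^ 3)) * (2 ^ n * (0 ^ 4 + 6 * 0 ^ 2 * n + 3 * n ^ 2 - 2 * n)) := by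
        rw [← hs2, ← sub_nonneg]
        have : (1 / s) * (2 ^ n * ((0 : ℝ) ^ 2 + s ^ 2)) - (1 / (6 * s ^ 3)) *
            (2 ^ n * (0 ^ 4 + 6 * 0 ^ 2 * s ^ 2 + 3 * (s ^ 2) ^ 2 - 2 * s ^ 2)) - 2 ^ n * (s / 2)
            = 2 ^ n / (3 * s) := by
          field_simp
          ring
        rw [this]
        positivity
    _ = ∑ b : Fin n → Fin 2, ((1 / s) * (0 + ∑ t, coinSign (b t)) ^ 2 -
          (1 / (6 * s ^ 3)) * (0 + ∑ t, coinSign (b t)) ^ 4) := by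
        rw [Finset.sum_sub_distrib, ← Finset.mul_sum, ← Finset.mul_sum, sum_coinSign_sq,
          sum_coinSign_pow_four]
    _ ≤ _ := Finset.sum_le_sum fun b _ => by simpa only [zero_add] using key _

theorem expect_pstar (n : ℕ) (f : (Fin n → ℕ) → ℝ) :
    expect pstar n f = (1 / 2) ^ n * ∑ b : Fin n → Fin 2, f fun t => (b t : ℕ) := by
  have hinj : Function.Injective fun (b : Fin n → Fin 2) (t : Fin n) => (b t : ℕ) :=
    fun b c h => funext fun t => Fin.ext (congrFun h t)
  rw [expect, ← hinj.tsum_eq, tsum_fintype, Finset.mul_sum]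
  · refine Finset.sum_congr rfl fun b _ => ?_
    simp only [wt, pstar, Fin.is_lt, if_true, Finset.prod_const, Finset.card_fin]
  · intro ω hω
    have hlt (t : Fin n) : ω t < 2 := by
      by_contra h
      have hw : wt pstar ω = 0 := Finset.prod_eq_zero (Finset.mem_univ t) (if_neg h)
      exact hω (by simp [hw])
    exact ⟨fun t => ⟨ω t, hlt t⟩, rfl⟩

theorem emp_nonneg (n : ℕ) (ω : Fin n → ℕ) (i : ℕ) : 0 ≤ emp n ω i := by
  unfold emp; positivity

theorem emp_le_one (n : ℕ) (ω : Fin n → ℕ) (i : ℕ) : emp n ω i ≤ 1 := by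
  refine div_le_one_of_le₀ ?_ n.cast_nonneg
  exact_mod_cast (Finset.card_filter_le _ _).trans_eq (Finset.card_fin n)

theorem emp_eq_sum (n : ℕ) (ω : Fin n → ℕ) (i : ℕ) :
    emp n ω i = (∑ t, if ω t = i then (1 : ℝ) else 0) / n := by
  simp [emp]

theorem Deln_pstar_ge {n : ℕ} (hn : 0 < n) : 1 / 4 / √n ≤ Deln pstar n := by
  have hn' : (0 : ℝ) < n := by exact_mod_cast hn
  have hs0 : 0 < √(n : ℝ) := Real.sqrt_pos.2 hn'
  have hs2 : √(n : ℝ) ^ 2 = n := Real.sq_sqrt hn'.le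
  rw [Deln, expect_pstar]
  have key (b : Fin n → Fin 2) : |∑ t, coinSign (b t)| * (1 / (2 * n)) ≤
      supNorm fun i => emp n (fun t => (b t : ℕ)) i - pstar i := by
    have hbdd : BddAbove (Set.range fun i => |emp n (fun t => (b t : ℕ)) i - pstar i|) := by
      refine ⟨1, ?_⟩
      rintro _ ⟨i, rfl⟩
      have h0 := emp_nonneg n (fun t => (b t : ℕ)) i
      have h1 := emp_le_one n (fun t => (b t : ℕ)) i
      simp only [pstar]
      split_ifs <;> rw [abs_le] <;> constructor <;> linarith
    refine le_trans (le_of_eq ?_) (le_ciSup hbdd 0)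
    have hsum : ∑ t, coinSign (b t) = 2 * (∑ t, if (b t : ℕ) = 0 then (1 : ℝ) else 0) - n := by
      have : (n : ℝ) = ∑ _t : Fin n, (1 : ℝ) := by simp
      rw [this, Finset.mul_sum, ← Finset.sum_sub_distrib]
      refine Finset.sum_congr rfl fun t _ => ?_
      simp only [coinSign, Fin.ext_iff, Fin.val_zero]
      split_ifs <;> norm_num
    have h0 : emp n (fun t => (b t : ℕ)) 0 - pstar 0 = (∑ t, coinSign (b t)) * (1 / (2 * n)) := by
      rw [emp_eq_sum, hsum]
      simp only [pstar, zero_lt_two, if_true]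
      field_simp
    rw [h0, abs_mul, abs_of_pos (show (0 : ℝ) < 1 / (2 * n) by positivity)]
  calc 1 / 4 / √(n : ℝ) = (1 / 2) ^ n * ((2 ^ n * (√n / 2)) * (1 / (2 * n))) := by
        rw [one_div_pow, show 1 / (2 * (n : ℝ)) = 1 / (2 * √n ^ 2) by rw [hs2]]
        field_simp
        norm_num
    _ ≤ (1 / 2) ^ n * ((∑ b : Fin n → Fin 2, |∑ t, coinSign (b t)|) * (1 / (2 * n))) := by
        gcongr
        exact sum_abs_coinSign_ge hn
    _ ≤ _ := by
        rw [Finset.sum_mul]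
        gcongr with b
        exact key b

open ProbabilityTheory ENNReal

theorem IsProbDist.hasSum {p : ℕ → ℝ} (hp : IsProbDist p) : HasSum p 1 := by
  have hs : Summable p := by
    by_contra h
    simpa [tsum_eq_zero_of_not_summable h] using hp.2
  exact hp.2 ▸ hs.hasSum

theorem IsProbDist.tsum_ofReal {p : ℕ → ℝ} (hp : IsProbDist p) :
    ∑' i, ENNReal.ofReal (p i) = 1 := by
  rw [← ENNReal.ofReal_tsum_of_nonneg hp.1 hp.hasSum.summable, hp.2, ENNReal.ofReal_one]

/-- The probability measure on `ℕ` with mass function `p`. -/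
def IsProbDist.measure {p : ℕ → ℝ} (hp : IsProbDist p) : Measure ℕ :=
  PMF.toMeasure ⟨fun i => ENNReal.ofReal (p i), hp.tsum_ofReal ▸ ENNReal.summable.hasSum⟩

instance IsProbDist.isProbabilityMeasure {p : ℕ → ℝ} (hp : IsProbDist p) :
    IsProbabilityMeasure hp.measure := by
  exact PMF.toMeasure.isProbabilityMeasure _

theorem IsProbDist.measure_singleton {p : ℕ → ℝ} (hp : IsProbDist p) (i : ℕ) :
    hp.measure {i} = ENNReal.ofReal (p i) :=
  PMF.toMeasure_apply_singleton _ _ (measurableSet_singleton i)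

theorem expect_eq_toReal_lintegral {p : ℕ → ℝ} (hp : IsProbDist p) (n : ℕ)
    {f : (Fin n → ℕ) → ℝ} (hf : ∀ ω, 0 ≤ f ω) :
    expect p n f = (∫⁻ ω, ENNReal.ofReal (f ω) ∂Measure.pi fun _ : Fin n => hp.measure).toReal := by
  have hw (ω : Fin n → ℕ) : 0 ≤ ∏ t, p (ω t) := Finset.prod_nonneg fun t _ => hp.1 _
  rw [lintegral_countable', ENNReal.tsum_toReal_eq]
  · refine tsum_congr fun ω => ?_
    simp only [Measure.pi_singleton, hp.measure_singleton]
    rw [← ENNReal.ofReal_prod_of_nonneg fun t _ => hp.1 _, ENNReal.toReal_mul,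
      ENNReal.toReal_ofReal (hf ω), ENNReal.toReal_ofReal (hw ω), mul_comm, wt]
  · intro ω
    simp only [Measure.pi_singleton, hp.measure_singleton]
    rw [← ENNReal.ofReal_prod_of_nonneg fun t _ => hp.1 _]
    finiteness

/-- The indicator function of the symbol `i`. -/
def symbolIndicator (i x : ℕ) : ℝ := if x = i then 1 else 0

theorem memLp_symbolIndicator (μ : Measure ℕ) [IsFiniteMeasure μ] (i : ℕ) :
    MemLp (symbolIndicator i) 2 μ :=
  MemLp.of_bound (Measurable.of_discrete).aestronglyMeasurable 1 <|
    ae_of_all _ fun x => by unfold symbolIndicator; split_ifs <;> simp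

theorem integral_symbolIndicator {p : ℕ → ℝ} (hp : IsProbDist p) (i : ℕ) :
    ∫ x, symbolIndicator i x ∂hp.measure = p i := by
  have : symbolIndicator i = Set.indicator {i} 1 := by
    ext x; simp [symbolIndicator, Set.indicator]
  rw [this, integral_indicator_one (measurableSet_singleton i), measureReal_def,
    hp.measure_singleton, ENNReal.toReal_ofReal (hp.1 i)]

theorem variance_symbolIndicator_le {p : ℕ → ℝ} (hp : IsProbDist p) (i : ℕ) :
    Var[symbolIndicator i; hp.measure] ≤ p i := by
  refine (variance_le_expectation_sq
    (Measurable.of_discrete).aestronglyMeasurable).trans_eq ?_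
  rw [← integral_symbolIndicator hp i]
  congr 1 with x
  simp [symbolIndicator]

theorem emp_eq_smul_sum (n : ℕ) (i : ℕ) :
    (fun ω : Fin n → ℕ => emp n ω i) =
      fun ω => (n : ℝ)⁻¹ * (∑ t, fun ω : Fin n → ℕ => symbolIndicator i (ω t)) ω := by
  ext ω
  rw [emp_eq_sum, div_eq_inv_mul, Finset.sum_apply]
  rfl

theorem lintegral_emp_sub_sq_le {p : ℕ → ℝ} (hp : IsProbDist p) {n : ℕ} (hn : 0 < n) (i : ℕ) :
    ∫⁻ ω, ENNReal.ofReal ((emp n ω i - p i) ^ 2) ∂(Measure.pi fun _ : Fin n => hp.measure) ≤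
      ENNReal.ofReal (p i / n) := by
  have hn' : (0 : ℝ) < n := by exact_mod_cast hn
  set P := Measure.pi fun _ : Fin n => hp.measure
  have hmem : MemLp (fun ω => emp n ω i) 2 P :=
    MemLp.of_bound (measurable_of_countable _).aestronglyMeasurable 1 <|
      ae_of_all _ fun ω => by
        rw [Real.norm_of_nonneg (emp_nonneg n ω i)]; exact emp_le_one n ω i
  have hmean : P[fun ω => emp n ω i] = p i := by
    rw [emp_eq_smul_sum]
    simp only [Finset.sum_apply]
    rw [integral_const_mul, integral_finsetSum]
    · have h (t : Fin n) : ∫ ω : Fin n → ℕ, symbolIndicator i (ω t) ∂P = p i := by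
        rw [← integral_symbolIndicator hp i]
        exact integral_comp_eval (μ := fun _ : Fin n => hp.measure)
          (Measurable.of_discrete).aestronglyMeasurable
      simp only [h, Finset.sum_const, Finset.card_fin, nsmul_eq_mul]
      field_simp
    · exact fun t _ => Integrable.of_bound (measurable_of_countable _).aestronglyMeasurable 1 <|
        ae_of_all _ fun x => by unfold symbolIndicator; split_ifs <;> simp
  have hvar : Var[fun ω => emp n ω i; P] ≤ p i / n := by
    rw [emp_eq_smul_sum, variance_const_mul,
      variance_sum_pi fun _ => memLp_symbolIndicator hp.measure i]
    simp only [Finset.sum_const, Finset.card_fin, nsmul_eq_mul]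
    calc _ ≤ ((n : ℝ)⁻¹) ^ 2 * (n * p i) := by
          gcongr; exact variance_symbolIndicator_le hp i
      _ = p i / n := by field_simp
  calc _ = evariance (fun ω => emp n ω i) P := by
        rw [evariance_eq_lintegral_ofReal, hmean]
    _ = ENNReal.ofReal (Var[fun ω => emp n ω i; P]) := (ofReal_variance hmem).symm
    _ ≤ _ := ENNReal.ofReal_le_ofReal hvar

theorem supNorm_nonneg (q : ℕ → ℝ) : 0 ≤ supNorm q := Real.iSup_nonneg fun _ => abs_nonneg _

theorem ofReal_supNorm_le (q : ℕ → ℝ) {s : ℝ} (hs : 0 < s) :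
    ENNReal.ofReal (supNorm q) ≤
      ENNReal.ofReal (s / 2) * ∑' i, ENNReal.ofReal (q i ^ 2) + ENNReal.ofReal (1 / (2 * s)) := by
  by_cases htop : ∑' i, ENNReal.ofReal (q i ^ 2) = ∞
  · rw [htop, ENNReal.mul_top (by simpa using hs)]
    simp
  refine ENNReal.ofReal_le_of_le_toReal (ciSup_le fun i => ?_)
  rw [← ENNReal.ofReal_le_iff_le_toReal (by finiteness)]
  calc ENNReal.ofReal |q i| ≤ ENNReal.ofReal (s / 2 * q i ^ 2 + 1 / (2 * s)) := by
        refine ENNReal.ofReal_le_ofReal ?_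
        rw [← sq_abs (q i), ← sub_nonneg]
        have : s / 2 * |q i| ^ 2 + 1 / (2 * s) - |q i| = (s * |q i| - 1) ^ 2 / (2 * s) := by
          field_simp
          ring
        rw [this]
        positivity
    _ = ENNReal.ofReal (s / 2) * ENNReal.ofReal (q i ^ 2) + ENNReal.ofReal (1 / (2 * s)) := by
        rw [ENNReal.ofReal_add (by positivity) (by positivity), ENNReal.ofReal_mul (by positivity)]
    _ ≤ _ := by
        gcongr
        exact ENNReal.le_tsum i

theorem Deln_le {p : ℕ → ℝ} (hp : IsProbDist p) {n : ℕ} (hn : 0 < n) :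
    Deln p n ≤ 1 / √n := by
  have hn' : (0 : ℝ) < n := by exact_mod_cast hn
  have hs0 : 0 < √(n : ℝ) := Real.sqrt_pos.2 hn'
  have hs2 : √(n : ℝ) ^ 2 = n := Real.sq_sqrt hn'.le
  rw [Deln, expect_eq_toReal_lintegral hp n fun _ => supNorm_nonneg _]
  refine ENNReal.toReal_le_of_le_ofReal (by positivity) ?_
  set P := Measure.pi fun _ : Fin n => hp.measure
  calc _ ≤ ∫⁻ ω, (ENNReal.ofReal (√n / 2) * ∑' i, ENNReal.ofReal ((emp n ω i - p i) ^ 2) +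
          ENNReal.ofReal (1 / (2 * √n))) ∂P :=
        lintegral_mono fun ω => ofReal_supNorm_le _ hs0
    _ = ENNReal.ofReal (√n / 2) * ∑' i, ∫⁻ ω, ENNReal.ofReal ((emp n ω i - p i) ^ 2) ∂P +
          ENNReal.ofReal (1 / (2 * √n)) := by
        rw [lintegral_add_right _ measurable_const, lintegral_const, measure_univ, mul_one,
          lintegral_const_mul _ (measurable_of_countable _),
          lintegral_tsum fun i => (measurable_of_countable _).aemeasurable]
    _ ≤ ENNReal.ofReal (√n / 2) * ∑' i, ENNReal.ofReal (p i / n) +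
          ENNReal.ofReal (1 / (2 * √n)) := by
        gcongr with i
        exact lintegral_emp_sub_sq_le hp hn i
    _ = ENNReal.ofReal (1 / √n) := by
        rw [← ENNReal.ofReal_tsum_of_nonneg (fun i => div_nonneg (hp.1 i) hn'.le)
          (hp.hasSum.summable.div_const _), tsum_div_const, hp.2,
          ← ENNReal.ofReal_mul (by positivity), ← ENNReal.ofReal_add (by positivity)
          (by positivity)]
        congr 1
        nth_rw 2 [← hs2]
        field_simp
        norm_num

theorem isProbDist_pstar : IsProbDist pstar := by
  refine ⟨fun i => by unfold pstar; split_ifs <;> norm_num, ?_⟩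
  rw [tsum_eq_sum (s := Finset.range 2) fun i hi => by simpa [pstar] using hi]
  simp [Finset.sum_range_succ, pstar]
  norm_num

/-- a fixed least-favorable distribution and the minimax rate. -/
theorem least_favorable_and_minimax :
    ∃ c : ℝ, 0 < c ∧ ∃ C : ℝ, 0 < C ∧ ∃ n₀ : ℕ, ∀ n : ℕ, n₀ ≤ n →
      (∀ p : ℕ → ℝ, IsProbDist p → c * Deln p n ≤ Deln pstar n) ∧
      c / Real.sqrt n ≤ (⨆ p : {q : ℕ → ℝ // IsProbDist q}, Deln p.1 n) ∧
      (⨆ p : {q : ℕ → ℝ // IsProbDist q}, Deln p.1 n) ≤ C / Real.sqrt n := by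
  refine ⟨1 / 4, by norm_num, 1, one_pos, 1, fun n hn => ?_⟩
  have : Nonempty {q : ℕ → ℝ // IsProbDist q} := ⟨⟨pstar, isProbDist_pstar⟩⟩
  have hbdd : BddAbove (Set.range fun p : {q : ℕ → ℝ // IsProbDist q} => Deln p.1 n) :=
    ⟨1 / √n, by rintro _ ⟨p, rfl⟩; exact Deln_le p.2 hn⟩
  refine ⟨fun p hp => ?_, ?_, ciSup_le fun p => Deln_le p.2 hn⟩
  · calc 1 / 4 * Deln p n ≤ 1 / 4 * (1 / √n) := by gcongr; exact Deln_le hp hn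
      _ = 1 / 4 / √n := by ring
      _ ≤ _ := Deln_pstar_ge hn
  · exact (Deln_pstar_ge hn).trans (le_ciSup hbdd ⟨pstar, isProbDist_pstar⟩)
end
end

section
/- For every probability distribution p on ℕ and every integer n ≥ 2, the functional M(p) satisfies 1/3 ≤ M(p) ≤ 5·log n. -/
open MeasureTheory
open scoped BigOperators

noncomputable section

theorem IsProbDist.summable {p : ℕ → ℝ} (hp : IsProbDist p) : Summable p := by
  by_contra h
  have := hp.2
  rw [tsum_eq_zero_of_not_summable h] at this
  exact zero_ne_one this

/-- The defining set of `dRe p k` is bounded above by `1 / k`. -/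
theorem IsProbDist.le_inv_of_forall_le {p : ℕ → ℝ} (hp : IsProbDist p) {s : Finset ℕ} {k : ℕ}
    (hk : 0 < k) (hs : s.card = k) {x : ℝ} (hx : ∀ i ∈ s, x ≤ p i) : x ≤ 1 / k := by
  have h1 : (s.card : ℝ) * x ≤ ∑ i ∈ s, p i := by
    simpa using Finset.card_nsmul_le_sum s p x hx
  have h2 : ∑ i ∈ s, p i ≤ 1 := hp.2 ▸ hp.summable.sum_le_tsum s fun i _ => hp.1 i
  rw [le_div_iff₀ (by positivity), mul_comm, ← hs]
  exact h1.trans h2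

theorem IsProbDist.dRe_le {p : ℕ → ℝ} (hp : IsProbDist p) {k : ℕ} (hk : 0 < k) :
    dRe p k ≤ 1 / k := by
  refine csSup_le ⟨0, Finset.range k, Finset.card_range k, fun i _ => hp.1 i⟩ ?_
  rintro x ⟨s, hs, hx⟩
  exact hp.le_inv_of_forall_le hk hs hx

theorem IsProbDist.le_dRe {p : ℕ → ℝ} (hp : IsProbDist p) {s : Finset ℕ} {k : ℕ}
    (hk : 0 < k) (hs : s.card = k) {x : ℝ} (hx : ∀ i ∈ s, x ≤ p i) : x ≤ dRe p k := by
  refine le_csSup ⟨1 / k, ?_⟩ ⟨s, hs, hx⟩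
  rintro y ⟨t, ht, hy⟩
  exact hp.le_inv_of_forall_le hk ht hy

/-- A sum over `m` atoms is at most the sum of the `m` largest atoms. -/
theorem IsProbDist.sum_le_sum_dRe {p : ℕ → ℝ} (hp : IsProbDist p) (m : ℕ) :
    ∀ s : Finset ℕ, s.card = m → ∑ i ∈ s, p i ≤ ∑ j ∈ Finset.range m, dRe p (j + 1) := by
  induction m with
  | zero => intro s hs; simp [Finset.card_eq_zero.mp hs]
  | succ m ih =>
    intro s hs
    obtain ⟨a, ha, hmin⟩ := s.exists_min_image p (Finset.card_pos.mp (by omega))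
    rw [Finset.sum_range_succ, ← Finset.sum_erase_add s p ha]
    exact add_le_add (ih _ (by rw [Finset.card_erase_of_mem ha]; omega))
      (hp.le_dRe m.succ_pos hs hmin)

theorem sum_range_half_inv_mul_succ (m : ℕ) :
    ∑ j ∈ Finset.range m, 1 / (2 * ((j : ℝ) + 1) * ((j : ℝ) + 2)) =
      (1 - 1 / ((m : ℝ) + 1)) / 2 := by
  induction m with
  | zero => simp
  | succ m ih =>
    rw [Finset.sum_range_succ, ih]
    push_cast
    field_simp
    ring

theorem IsProbDist.exists_le_dRe {p : ℕ → ℝ} (hp : IsProbDist p) :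
    ∃ j : ℕ, 1 / (2 * ((j : ℝ) + 1) * ((j : ℝ) + 2)) ≤ dRe p (j + 1) := by
  by_contra! h
  have : ∑' i, p i ≤ 1 / 2 := by
    refine hp.summable.tsum_le_of_sum_le fun s => (hp.sum_le_sum_dRe _ s rfl).trans ?_
    refine (Finset.sum_le_sum fun j _ => (h j).le).trans ?_
    rw [sum_range_half_inv_mul_succ]
    have : (0 : ℝ) ≤ 1 / ((s.card : ℝ) + 1) := by positivity
    linarith
  rw [hp.2] at this
  norm_num at this

theorem IsProbDist.Mfun_term_le {p : ℕ → ℝ} (hp : IsProbDist p) {n : ℕ} (hn : 2 ≤ n) (j : ℕ) :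
    (if 0 < (n : ℝ) * dRe p (j + 1) then
      Real.log ((j : ℝ) + 2) /
        Real.log (2 + Real.log ((j : ℝ) + 2) / ((n : ℝ) * dRe p (j + 1)))
    else 0) ≤ 5 * Real.log n := by
  have hn2 : (2 : ℝ) ≤ n := by exact_mod_cast hn
  have hj : (0 : ℝ) ≤ j := j.cast_nonneg
  have hlog2 := Real.log_two_gt_d9
  have hlogn : Real.log 2 ≤ Real.log n := Real.log_le_log two_pos hn2
  split_ifs with hpos
  swap
  · linarith
  have hd : 0 < dRe p (j + 1) := pos_of_mul_pos_right hpos (by linarith)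
  have hL : 0 < Real.log ((j : ℝ) + 2) := Real.log_pos (by linarith)
  have hq : 0 < Real.log ((j : ℝ) + 2) / ((n : ℝ) * dRe p (j + 1)) := div_pos hL hpos
  have hden : Real.log 2 ≤ Real.log (2 + Real.log ((j : ℝ) + 2) / ((n : ℝ) * dRe p (j + 1))) :=
    Real.log_le_log two_pos (by linarith)
  rw [div_le_iff₀ (by linarith)]
  rcases le_or_gt (Real.log ((j : ℝ) + 2)) (3 * Real.log n) with hc | hc
  · nlinarith
  · have hdj : dRe p (j + 1) * (j + 1) ≤ 1 := by
      have := hp.dRe_le j.succ_pos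
      push_cast at this
      rwa [le_div_iff₀ (by linarith)] at this
    have hle : ((j : ℝ) + 2) / n ≤
        2 + Real.log ((j : ℝ) + 2) / ((n : ℝ) * dRe p (j + 1)) := by
      have h1 : ((j : ℝ) + 1) / n ≤ Real.log ((j : ℝ) + 2) / ((n : ℝ) * dRe p (j + 1)) := by
        rw [div_le_div_iff₀ (by linarith) hpos]
        nlinarith
      have h2 : 1 / (n : ℝ) ≤ 1 := by
        rw [div_le_one (by linarith)]
        linarith
      have h3 : ((j : ℝ) + 2) / n = (j + 1) / n + 1 / n := by ring
      linarith
    have hlog := Real.log_le_log (by positivity) hle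
    rw [Real.log_div (by linarith) (by linarith)] at hlog
    nlinarith

theorem IsProbDist.exists_one_third_le_Mfun_term {p : ℕ → ℝ} (hp : IsProbDist p) {n : ℕ}
    (hn : 2 ≤ n) :
    ∃ j : ℕ, 1 / 3 ≤ if 0 < (n : ℝ) * dRe p (j + 1) then
      Real.log ((j : ℝ) + 2) /
        Real.log (2 + Real.log ((j : ℝ) + 2) / ((n : ℝ) * dRe p (j + 1)))
    else 0 := by
  obtain ⟨j, hd⟩ := hp.exists_le_dRe
  have hn2 : (2 : ℝ) ≤ n := by exact_mod_cast hn
  have hj : (0 : ℝ) ≤ j := j.cast_nonneg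
  have hdpos : 0 < dRe p (j + 1) := lt_of_lt_of_le (by positivity) hd
  have hpos : 0 < (n : ℝ) * dRe p (j + 1) := mul_pos (by linarith) hdpos
  refine ⟨j, ?_⟩
  rw [if_pos hpos]
  have hL : 0 < Real.log ((j : ℝ) + 2) := Real.log_pos (by linarith)
  have hL' : Real.log ((j : ℝ) + 2) ≤ j + 1 := by
    linarith [Real.log_le_sub_one_of_pos (show (0 : ℝ) < (j : ℝ) + 2 by linarith)]
  have hq : 0 < Real.log ((j : ℝ) + 2) / ((n : ℝ) * dRe p (j + 1)) := div_pos hL hpos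
  have hnd : 1 ≤ (n : ℝ) * dRe p (j + 1) * ((j + 1) * (j + 2)) := by
    rw [div_le_iff₀ (by positivity)] at hd
    have : 0 ≤ ((n : ℝ) - 2) * (dRe p (j + 1) * ((j + 1) * (j + 2))) :=
      mul_nonneg (by linarith) (by positivity)
    linarith
  have hle : Real.log ((j : ℝ) + 2) / ((n : ℝ) * dRe p (j + 1)) ≤ (j + 1) * ((j + 1) * (j + 2)) := by
    rw [div_le_iff₀ hpos]
    nlinarith
  have hcube : 2 + Real.log ((j : ℝ) + 2) / ((n : ℝ) * dRe p (j + 1)) ≤ ((j : ℝ) + 2) ^ 3 := by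
    nlinarith
  have hlog := Real.log_le_log (by linarith) hcube
  rw [Real.log_pow] at hlog
  push_cast at hlog
  rw [le_div_iff₀ (Real.log_pos (by linarith))]
  linarith

/-- for every probability distribution `p` and every `n ≥ 2`,
`1/3 ≤ M(p) ≤ 5 log n`. -/
theorem M_bounds (p : ℕ → ℝ) (hp : IsProbDist p) (n : ℕ) (hn : 2 ≤ n) :
    1 / 3 ≤ Mfun p n ∧ Mfun p n ≤ 5 * Real.log n := by
  obtain ⟨j, hj⟩ := hp.exists_one_third_le_Mfun_term hn
  have hbdd := hp.Mfun_term_le hn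
  unfold Mfun
  exact ⟨le_ciSup_of_le ⟨5 * Real.log n, Set.forall_mem_range.mpr hbdd⟩ j hj, ciSup_le hbdd⟩
end
end

section
/- There exists a universal constant C₂ > 0 such that the distribution p on ℕ with p_i = (6/π²)·i^{-2} for all i ≥ 1 satisfies M(p) ≥ C₂·log n for every integer n ≥ 9. -/
open MeasureTheory
open scoped BigOperators

noncomputable section

/-- The distribution `p_i = (6/π²)·i^{-2}` for `i ≥ 1` (here indexed from `0`,
so position `i` carries mass `(6/π²)/(i+1)²`). -/
def pInvSq : ℕ → ℝ := fun i => (6 / Real.pi ^ 2) / ((i : ℝ) + 1) ^ 2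

theorem pInvSq_pos (i : ℕ) : 0 < pInvSq i := by
  unfold pInvSq
  positivity

theorem pInvSq_antitone : Antitone pInvSq := by
  intro a b hab
  unfold pInvSq
  gcongr

theorem isProbDist_pInvSq : IsProbDist pInvSq := by
  refine ⟨fun i => (pInvSq_pos i).le, ?_⟩
  have h : HasSum (fun i : ℕ => 1 / ((i + 1 : ℕ) : ℝ) ^ 2) (Real.pi ^ 2 / 6) := by
    refine (hasSum_nat_add_iff (f := fun i : ℕ => 1 / (i : ℝ) ^ 2) 1).2 ?_
    simpa using hasSum_zeta_two
  have h' := h.mul_left (6 / Real.pi ^ 2)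
  have hpi := Real.pi_pos.ne'
  rw [show 6 / Real.pi ^ 2 * (Real.pi ^ 2 / 6) = 1 by field_simp] at h'
  rw [← h'.tsum_eq]
  refine tsum_congr fun i => ?_
  simp [pInvSq, div_eq_mul_inv]

/-- The rearrangement of a nonincreasing sequence is the sequence itself. -/
theorem dRe_succ_of_antitone {p : ℕ → ℝ} (hp : Antitone p) (j : ℕ) : dRe p (j + 1) = p j := by
  refine IsGreatest.csSup_eq ⟨⟨Finset.range (j + 1), Finset.card_range _, fun i hi => ?_⟩, ?_⟩
  · exact hp (Nat.lt_succ_iff.1 (Finset.mem_range.1 hi))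
  · rintro x ⟨s, hs, hx⟩
    obtain ⟨i, hi, hij⟩ : ∃ i ∈ s, j ≤ i := by
      by_contra! h
      have := Finset.card_le_card (fun i hi => Finset.mem_range.2 (h i hi) : s ⊆ Finset.range j)
      rw [Finset.card_range] at this
      omega
    exact (hx i hi).trans (hp hij)

theorem inv_pInvSq (i : ℕ) : (pInvSq i)⁻¹ = Real.pi ^ 2 / 6 * ((i : ℝ) + 1) ^ 2 := by
  simp [pInvSq, div_eq_mul_inv, mul_comm]

/-- For `pInvSq` neither the rearrangement nor the case distinction in `M(p)` matters. -/
theorem Mfun_pInvSq {n : ℕ} (hn : 0 < n) :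
    Mfun pInvSq n = ⨆ j : ℕ, Real.log ((j : ℝ) + 2) /
      Real.log (2 + Real.log ((j : ℝ) + 2) / ((n : ℝ) * pInvSq j)) := by
  unfold Mfun
  refine iSup_congr fun j => ?_
  rw [dRe_succ_of_antitone pInvSq_antitone, if_pos]
  have := pInvSq_pos j
  positivity

theorem half_le_log_add_two {x : ℝ} (hx : 0 ≤ x) : 1 / 2 ≤ Real.log (2 + x) := by
  have h1 : Real.log 2 ≤ Real.log (2 + x) := Real.log_le_log (by norm_num) (by linarith)
  linarith [Real.log_two_gt_d9]

theorem bddAbove_Mfun_terms {n : ℕ} (hn : 0 < n) :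
    BddAbove (Set.range fun j : ℕ => Real.log ((j : ℝ) + 2) /
      Real.log (2 + Real.log ((j : ℝ) + 2) / ((n : ℝ) * pInvSq j))) := by
  refine ⟨1 + 2 * Real.log (4 * n), ?_⟩
  rintro _ ⟨j, rfl⟩
  have hn' : (1 : ℝ) ≤ n := by exact_mod_cast hn
  have hj : (0 : ℝ) ≤ j := j.cast_nonneg
  have hp := pInvSq_pos j
  have hlog : 1 / 2 ≤ Real.log ((j : ℝ) + 2) := by
    simpa [add_comm] using half_le_log_add_two hj
  set L := Real.log ((j : ℝ) + 2) with hL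
  have hq : ((j : ℝ) + 2) / 2 ≤ (pInvSq j)⁻¹ := by
    rw [inv_pInvSq]
    have hpi : 1 ≤ Real.pi ^ 2 / 6 := by nlinarith [Real.pi_gt_three]
    nlinarith [sq_nonneg (j : ℝ), sq_nonneg ((j : ℝ) + 1)]
  have hy : ((j : ℝ) + 2) / (4 * n) ≤ L / (n * pInvSq j) := by
    calc ((j : ℝ) + 2) / (4 * n) = 1 / 2 * (((j : ℝ) + 2) / 2) / n := by field_simp; norm_num
      _ ≤ L * (pInvSq j)⁻¹ / n := by gcongr
      _ = L / (n * pInvSq j) := by field_simp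
  have hD : 1 / 2 ≤ Real.log (2 + L / (n * pInvSq j)) := half_le_log_add_two (by positivity)
  have hD' : L - Real.log (4 * n) ≤ Real.log (2 + L / (n * pInvSq j)) := by
    rw [hL, ← Real.log_div (by positivity) (by positivity)]
    exact Real.log_le_log (by positivity) (by linarith)
  have h4n : 0 ≤ Real.log (4 * n) := Real.log_nonneg (by linarith)
  change L / _ ≤ _
  rw [div_le_iff₀ (by linarith)]
  nlinarith

theorem log_div_eight_le_term {n m : ℕ} (hlow : (m + 1) ^ 4 ≤ n) (hup : n < (m + 2) ^ 4) :
    1 / 8 * Real.log n ≤ Real.log ((m : ℝ) + 2) /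
      Real.log (2 + Real.log ((m : ℝ) + 2) / ((n : ℝ) * pInvSq m)) := by
  have hlow' : ((m : ℝ) + 1) ^ 4 ≤ n := by exact_mod_cast hlow
  have hup' : (n : ℝ) ≤ ((m : ℝ) + 2) ^ 4 := by exact_mod_cast hup.le
  have hm : (0 : ℝ) ≤ m := m.cast_nonneg
  have hn : (0 : ℝ) < n := lt_of_lt_of_le (by positivity) hlow'
  have hp := pInvSq_pos m
  have hlog : 1 / 2 ≤ Real.log ((m : ℝ) + 2) := by
    simpa [add_comm] using half_le_log_add_two hm
  have hL : Real.log ((m : ℝ) + 2) ≤ m + 1 := by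
    linarith [Real.log_le_sub_one_of_pos (show (0 : ℝ) < (m : ℝ) + 2 by positivity)]
  have hnL : Real.log n ≤ 4 * Real.log ((m : ℝ) + 2) := by
    calc Real.log n ≤ Real.log (((m : ℝ) + 2) ^ 4) := Real.log_le_log hn hup'
      _ = 4 * Real.log ((m : ℝ) + 2) := by rw [Real.log_pow]; norm_num
  have hy : Real.log ((m : ℝ) + 2) / (n * pInvSq m) ≤ 2 := by
    have hpi : Real.pi ^ 2 / 6 ≤ 2 := by nlinarith [Real.pi_lt_d2, Real.pi_gt_three]
    calc Real.log ((m : ℝ) + 2) / (n * pInvSq m)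
        = Real.log ((m : ℝ) + 2) * (pInvSq m)⁻¹ / n := by field_simp
      _ ≤ ((m : ℝ) + 1) * (2 * ((m : ℝ) + 1) ^ 2) / n := by
        rw [inv_pInvSq]
        gcongr
      _ ≤ 2 := by
        rw [div_le_iff₀ hn]
        nlinarith [pow_nonneg (show (0 : ℝ) ≤ (m : ℝ) + 1 by positivity) 3]
  have hD := half_le_log_add_two
    (show 0 ≤ Real.log ((m : ℝ) + 2) / (n * pInvSq m) by positivity)
  have hD' : Real.log (2 + Real.log ((m : ℝ) + 2) / (n * pInvSq m)) ≤ 2 := by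
    calc _ ≤ Real.log (2 ^ 2) := Real.log_le_log (by positivity) (by linarith)
      _ = 2 * Real.log 2 := by rw [Real.log_pow]; norm_num
      _ ≤ 2 := by linarith [Real.log_two_lt_d9]
  rw [le_div_iff₀ (by linarith)]
  nlinarith

/-- `M(p) ≥ C₂ log n` for the quadratically decaying distribution. -/
theorem M_large_for_invSq :
    ∃ C₂ : ℝ, 0 < C₂ ∧ IsProbDist pInvSq ∧
      ∀ n : ℕ, 9 ≤ n → C₂ * Real.log n ≤ Mfun pInvSq n := by
  refine ⟨1 / 8, by norm_num, isProbDist_pInvSq, fun n hn => ?_⟩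
  have hn0 : 0 < n := by omega
  rw [Mfun_pInvSq hn0]
  obtain ⟨m, hm⟩ : ∃ m, n.sqrt.sqrt = m + 1 :=
    Nat.exists_eq_succ_of_ne_zero (Nat.sqrt_pos.2 (Nat.sqrt_pos.2 hn0)).ne'
  refine le_ciSup_of_le (bddAbove_Mfun_terms hn0) m (log_div_eight_le_term ?_ ?_)
  · calc (m + 1) ^ 4 = ((n.sqrt.sqrt) ^ 2) ^ 2 := by rw [hm]; ring
      _ ≤ n.sqrt ^ 2 := Nat.pow_le_pow_left (Nat.sqrt_le' _) 2
      _ ≤ n := Nat.sqrt_le' n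
  · calc n < (n.sqrt + 1) ^ 2 := Nat.lt_succ_sqrt' n
      _ ≤ ((n.sqrt.sqrt + 1) ^ 2) ^ 2 := Nat.pow_le_pow_left (Nat.lt_succ_sqrt' n.sqrt) 2
      _ = (m + 2) ^ 4 := by rw [hm]; ring
end
end

section
/- Fix p ∈ (0, 1/2]. For any x > 0 and y ≥ 1 satisfying p + x·y ≤ 1/2, the Bernoulli Kullback–Leibler divergence satisfies kl(p + x·y ‖ p) ≤ 8·y²·kl(p + x ‖ p). -/
noncomputable section

/-- Bernoulli Kullback–Leibler divergence `kl(q ‖ p)`. -/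
def klBer (q p : ℝ) : ℝ := q * Real.log (q / p) + (1 - q) * Real.log ((1 - q) / (1 - p))

/-- A function with nonnegative derivative on `[0, x]` that vanishes at `0` is nonnegative at `x`. -/
lemma nonneg_of_hasDerivAt_nonneg {f f' : ℝ → ℝ} {x : ℝ} (hx : 0 ≤ x) (h0 : f 0 = 0)
    (hf : ∀ t ∈ Set.Icc 0 x, HasDerivAt f (f' t) t) (hf' : ∀ t ∈ Set.Icc 0 x, 0 ≤ f' t) :
    0 ≤ f x := by
  have hmono : MonotoneOn f (Set.Icc 0 x) :=
    monotoneOn_of_hasDerivWithinAt_nonneg (convex_Icc 0 x)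
      (fun t ht => (hf t ht).continuousAt.continuousWithinAt)
      (fun t ht => (hf t (interior_subset ht)).hasDerivWithinAt)
      (fun t ht => hf' t (interior_subset ht))
  simpa [h0] using hmono (Set.left_mem_Icc.2 hx) (Set.right_mem_Icc.2 hx) hx

/-- The derivative of `t ↦ klBer (p + t) p`. -/
def klBerSlope (p t : ℝ) : ℝ :=
  Real.log (p + t) - Real.log p - (Real.log (1 - (p + t)) - Real.log (1 - p))

lemma klBerSlope_zero (p : ℝ) : klBerSlope p 0 = 0 := by
  simp [klBerSlope]

lemma klBer_self {p : ℝ} (hp : 0 < p) (hp1 : p < 1) : klBer p p = 0 := by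
  simp [klBer, div_self hp.ne', div_self (sub_pos.2 hp1).ne']

lemma hasDerivAt_klBerSlope {p t : ℝ} (h0 : 0 < p + t) (h1 : p + t < 1) :
    HasDerivAt (klBerSlope p) (1 / ((p + t) * (1 - (p + t)))) t := by
  have hadd : HasDerivAt (fun t : ℝ => p + t) 1 t := (hasDerivAt_id t).const_add p
  have h1' : 1 - (p + t) ≠ 0 := (sub_pos.2 h1).ne'
  have h := ((hadd.log h0.ne').sub_const (Real.log p)).sub
    (((hadd.const_sub 1).log h1').sub_const (Real.log (1 - p)))
  refine h.congr_deriv ?_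
  have h0' := h0.ne'
  field_simp
  ring

lemma hasDerivAt_klBer {p t : ℝ} (hp : 0 < p) (hp1 : p < 1) (h0 : 0 < p + t) (h1 : p + t < 1) :
    HasDerivAt (fun t => klBer (p + t) p) (klBerSlope p t) t := by
  have hadd : HasDerivAt (fun t : ℝ => p + t) 1 t := (hasDerivAt_id t).const_add p
  have hp' := hp.ne'
  have hp1' : 1 - p ≠ 0 := (sub_pos.2 hp1).ne'
  have h0' := h0.ne'
  have h1' : 1 - (p + t) ≠ 0 := (sub_pos.2 h1).ne'
  have h := (hadd.mul ((hadd.div_const p).log (div_ne_zero h0' hp'))).add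
    ((hadd.const_sub 1).mul (((hadd.const_sub 1).div_const (1 - p)).log (div_ne_zero h1' hp1')))
  refine h.congr_deriv ?_
  rw [klBerSlope, Real.log_div h0' hp', Real.log_div h1' hp1']
  field_simp
  ring

lemma klBerSlope_nonneg {p t : ℝ} (hp : 0 < p) (ht : 0 ≤ t) (h1 : p + t < 1) :
    0 ≤ klBerSlope p t := by
  have h₁ : Real.log p ≤ Real.log (p + t) := Real.log_le_log hp (by linarith)
  have h₂ : Real.log (1 - (p + t)) ≤ Real.log (1 - p) :=
    Real.log_le_log (by linarith) (by linarith)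
  rw [klBerSlope]
  linarith

lemma klBer_add_nonneg {p x : ℝ} (hp : 0 < p) (hx : 0 ≤ x) (h1 : p + x < 1) :
    0 ≤ klBer (p + x) p := by
  exact nonneg_of_hasDerivAt_nonneg (f := fun t => klBer (p + t) p) hx
    (by simpa using klBer_self hp (by linarith))
    (fun t ht => hasDerivAt_klBer hp (by linarith) (by linarith [ht.1]) (by linarith [ht.2]))
    (fun t ht => klBerSlope_nonneg hp ht.1 (by linarith [ht.2]))

lemma klBerSlope_mul_le {p x y : ℝ} (hp : 0 < p) (hx : 0 ≤ x) (hy : 1 ≤ y)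
    (hxy : p + x * y ≤ 1 / 2) : klBerSlope p (x * y) ≤ y * klBerSlope p x := by
  have hle : ∀ t ∈ Set.Icc 0 x, t ≤ t * y ∧ p + t * y ≤ 1 / 2 := fun t ht =>
    ⟨le_mul_of_one_le_right ht.1 hy, by nlinarith [ht.2]⟩
  refine sub_nonneg.1 (nonneg_of_hasDerivAt_nonneg
    (f := fun t => y * klBerSlope p t - klBerSlope p (t * y))
    (f' := fun t => y * (1 / ((p + t) * (1 - (p + t)))) -
      1 / ((p + t * y) * (1 - (p + t * y))) * y) hx (by simp [klBerSlope_zero]) ?_ ?_)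
  · intro t ht
    obtain ⟨h₁, h₂⟩ := hle t ht
    have ht0 := ht.1
    exact ((hasDerivAt_klBerSlope (by linarith) (by linarith)).const_mul y).sub
      ((hasDerivAt_klBerSlope (by linarith) (by linarith)).comp t (hasDerivAt_mul_const y))
  · intro t ht
    obtain ⟨h₁, h₂⟩ := hle t ht
    have ht0 := ht.1
    have h : 1 / ((p + t * y) * (1 - (p + t * y))) ≤ 1 / ((p + t) * (1 - (p + t))) :=
      one_div_le_one_div_of_le (mul_pos (by linarith) (by linarith)) (by nlinarith)
    nlinarith

/-- On `[p, 1/2]` the divergence grows at most quadratically in the distance to `p`. -/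
lemma klBer_add_mul_le {p x y : ℝ} (hp : 0 < p) (hx : 0 ≤ x) (hy : 1 ≤ y)
    (hxy : p + x * y ≤ 1 / 2) : klBer (p + x * y) p ≤ y ^ 2 * klBer (p + x) p := by
  have hle : ∀ t ∈ Set.Icc 0 x, t ≤ t * y ∧ p + t * y ≤ 1 / 2 := fun t ht =>
    ⟨le_mul_of_one_le_right ht.1 hy, by nlinarith [ht.2]⟩
  have hp1 : p < 1 := by nlinarith
  refine sub_nonneg.1 (nonneg_of_hasDerivAt_nonneg
    (f := fun t => y ^ 2 * klBer (p + t) p - klBer (p + t * y) p)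
    (f' := fun t => y ^ 2 * klBerSlope p t - klBerSlope p (t * y) * y) hx
    (by simp [klBer_self hp hp1]) ?_ ?_)
  · intro t ht
    obtain ⟨h₁, h₂⟩ := hle t ht
    have ht0 := ht.1
    have hcomp := (hasDerivAt_klBer hp hp1 (t := t * y) (by linarith) (by linarith)).comp t
      (hasDerivAt_mul_const y)
    exact ((hasDerivAt_klBer hp hp1 (by linarith) (by linarith)).const_mul (y ^ 2)).sub hcomp
  · intro t ht
    nlinarith [klBerSlope_mul_le hp ht.1 hy (hle t ht).2]

/-- global scaling of the Bernoulli KL divergence. -/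
theorem kl_scaling_global (p : ℝ) (hp : p ∈ Set.Ioc (0 : ℝ) (1 / 2))
    (x : ℝ) (hx : 0 < x) (y : ℝ) (hy : 1 ≤ y) (hxy : p + x * y ≤ 1 / 2) :
    klBer (p + x * y) p ≤ 8 * y ^ 2 * klBer (p + x) p := by
  have hx1 : p + x < 1 := by nlinarith
  have h := mul_nonneg (sq_nonneg y) (klBer_add_nonneg hp.1 hx.le hx1)
  linarith [klBer_add_mul_le hp.1 hx.le hy hxy]
end
end

section
/- Let p ∈ (0, 1/2] and t > 0 with p + t ≤ 1/2. Then the Bernoulli Kullback–Leibler divergence satisfies kl(p + t ‖ p) ≥ (t/2)·log(1 + t/p). -/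
noncomputable section

/-- global lower bound for the Bernoulli KL divergence. -/
theorem kl_lower_bound (p : ℝ) (hp : p ∈ Set.Ioc (0 : ℝ) (1 / 2))
    (t : ℝ) (ht : 0 < t) (hpt : p + t ≤ 1 / 2) :
    t / 2 * Real.log (1 + t / p) ≤ klBer (p + t) p := by
  obtain ⟨hp0, -⟩ := hp
  have h1p : 0 < 1 - p := by linarith
  have h1q : 0 < 1 - (p + t) := by linarith
  have hfirst : t ≤ (p + t / 2) * Real.log (1 + t / p) := by
    have h := Real.le_log_one_add_of_nonneg (div_pos ht hp0).le
    calc t = (p + t / 2) * (2 * (t / p) / (t / p + 2)) := by field_simp; ring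
      _ ≤ _ := by gcongr
  have hsecond : -t ≤ (1 - (p + t)) * Real.log ((1 - (p + t)) / (1 - p)) := by
    have h := Real.one_sub_inv_le_log_of_pos (div_pos h1q h1p)
    calc -t = (1 - (p + t)) * (1 - ((1 - (p + t)) / (1 - p))⁻¹) := by
          rw [inv_div, mul_sub, mul_div_cancel₀ _ h1q.ne']; ring
      _ ≤ _ := by gcongr
  have hq : (p + t) / p = 1 + t / p := by field_simp
  rw [klBer, hq]
  linarith
end
end

section
/- Let h = (h_i)_{i≥1} be the harmonic sequence h_i = 1/i, and define M(h) := sup_{j≥1} log(j+1)/log(2 + j·log(j+1)/n). Then for every integer n ≥ 2, M(h) < 5·log n. -/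
noncomputable section

/-- The functional `M` for the harmonic sequence `h_i = 1/i` (`i ≥ 1`):
`M(h) = sup_{j ≥ 1} log(j+1)/log(2 + log(j+1)/(n·h_j)) = sup_{j ≥ 1} log(j+1)/log(2 + j·log(j+1)/n)`. -/
def Mharm (n : ℕ) : ℝ :=
  ⨆ j : ℕ, Real.log ((j : ℝ) + 2) /
    Real.log (2 + ((j : ℝ) + 1) * Real.log ((j : ℝ) + 2) / n)

/-- Two regimes give the same bound: for `x ≤ n ^ 2` the denominator is at least `log 2`, and for
`x ≥ n ^ 2` its argument is at least `√x`. -/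
lemma log_le_mul_log_two_add {n x : ℝ} (hn : 2 ≤ n) (hx : 2 ≤ x) :
    Real.log x ≤
      2 * Real.log n / Real.log 2 * Real.log (2 + (x - 1) * Real.log x / n) := by
  have h2 := Real.log_two_gt_d9
  have hlog2 : 0 < Real.log 2 := by linarith
  have hlogn : Real.log 2 ≤ Real.log n := Real.log_le_log (by norm_num) hn
  have hlogx : Real.log 2 ≤ Real.log x := Real.log_le_log (by norm_num) hx
  have hn0 : 0 < n := by linarith
  have ht : 0 ≤ (x - 1) * Real.log x / n :=
    div_nonneg (mul_nonneg (by linarith) (by linarith)) hn0.le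
  set t := (x - 1) * Real.log x / n with ht_def
  have hD : Real.log 2 ≤ Real.log (2 + t) := Real.log_le_log (by norm_num) (by linarith)
  rcases le_total x (n ^ 2) with hxn | hxn
  · calc Real.log x ≤ Real.log (n ^ 2) := Real.log_le_log (by linarith) hxn
      _ = 2 * Real.log n / Real.log 2 * Real.log 2 := by
        rw [Real.log_pow, Nat.cast_ofNat, div_mul_cancel₀ _ hlog2.ne']
      _ ≤ _ := by gcongr; exact div_nonneg (by linarith) hlog2.le
  · have hx4 : 4 ≤ x := by nlinarith
    have hL : 2 * Real.log n ≤ Real.log x := by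
      have := Real.log_le_log (by positivity) hxn
      rwa [Real.log_pow, Nat.cast_ofNat] at this
    have hxt : x ≤ (x - 1) * Real.log x := by nlinarith
    have hxt' : x / n ≤ t := by rw [ht_def]; gcongr
    have hx_sq : x ≤ (2 + t) ^ 2 := by
      calc x = x * 1 := (mul_one x).symm
        _ ≤ x * (x / n ^ 2) := by
          gcongr
          rwa [one_le_div (by positivity)]
        _ = (x / n) ^ 2 := by ring
        _ ≤ (2 + t) ^ 2 := by gcongr; linarith
    calc Real.log x ≤ Real.log ((2 + t) ^ 2) := Real.log_le_log (by linarith) hx_sq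
      _ = 2 * Real.log (2 + t) := by rw [Real.log_pow, Nat.cast_ofNat]
      _ ≤ _ := by
        gcongr
        · linarith
        · rw [le_div_iff₀ hlog2]; linarith

/-- `M(h) < 5 log n` for every `n ≥ 2`. -/
theorem M_harmonic_upper_bound (n : ℕ) (hn : 2 ≤ n) :
    Mharm n < 5 * Real.log n := by
  have h2 := Real.log_two_gt_d9
  have hlog2 : 0 < Real.log 2 := by linarith
  have hn' : (2 : ℝ) ≤ n := by exact_mod_cast hn
  have hlogn : 0 < Real.log n := Real.log_pos (by linarith)
  have hM : Mharm n ≤ 2 * Real.log n / Real.log 2 := by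
    refine ciSup_le fun j => ?_
    have hj : (0 : ℝ) ≤ j := j.cast_nonneg
    have hL : 0 < Real.log ((j : ℝ) + 2) := Real.log_pos (by linarith)
    have key := log_le_mul_log_two_add hn' (x := (j : ℝ) + 2) (by linarith)
    rw [show (j : ℝ) + 2 - 1 = j + 1 by ring] at key
    have ht : 0 ≤ ((j : ℝ) + 1) * Real.log ((j : ℝ) + 2) / n := by positivity
    rwa [div_le_iff₀ (Real.log_pos (by linarith))]
  refine hM.trans_lt ?_
  rw [div_lt_iff₀ hlog2]
  nlinarith
end
end
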